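/- Let k be an algebraically closed field of characteristic 0 and F = k(x,y) the rational function field in two variables. Let φ* : F → F be an injective k-algebra homomorphism (the pullback of a dominant rational map 𝔸² ⇢ 𝔸²). Then φ* fixes the symbol {x,y} in K₂(F)/Const (i.e. {φ*(x), φ*(y)} = {x,y} in K₂(F)/Const) if and only if φ* fixes the logarithmic volume form dlog x ∧ dlog y in Ω²_{F/k} (i.e. dlog(φ*(x)) ∧ dlog(φ*(y)) = dlog x ∧ dlog y). -/

import Mathlib

open scoped TensorProduct

/-- Pre-K₂: the tensor square (over ℤ) of the unit group `F*`, written additively. -/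
abbrev K2Pre (F : Type) [Field F] : Type :=
  (Additive Fˣ) ⊗[ℤ] (Additive Fˣ)

/-- The subgroup of Steinberg relations, generated by the elements `f ⊗ (1 - f)`
for `f ∈ F*`, `f ≠ 1`. -/
noncomputable def steinberg (F : Type) [Field F] : Submodule ℤ (K2Pre F) :=
  Submodule.span ℤ {t | ∃ (f : Fˣ) (h : (1 : F) - (f : F) ≠ 0),
    t = Additive.ofMul f ⊗ₜ[ℤ] Additive.ofMul (Units.mk0 ((1 : F) - (f : F)) h)}

/-- The second Milnor K-group `K₂ᴹ(F)`. -/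
noncomputable abbrev MilnorK2 (F : Type) [Field F] : Type :=
  K2Pre F ⧸ steinberg F

/-- The symbol `{f, g} ∈ K₂ᴹ(F)`. -/
noncomputable def MilnorK2.symbol {F : Type} [Field F] (f g : Fˣ) : MilnorK2 F :=
  Submodule.Quotient.mk (Additive.ofMul f ⊗ₜ[ℤ] Additive.ofMul g)

/-- The subgroup of `K₂ᴹ(F)` generated by the symbols `{f, c}` with `f ∈ F*`, `c ∈ k*`. -/
noncomputable def constSymbols (k F : Type) [Field k] [Field F] [Algebra k F] :
    AddSubgroup (MilnorK2 F) :=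
  AddSubgroup.closure {ξ | ∃ (f : Fˣ) (c : kˣ),
    ξ = MilnorK2.symbol f (Units.map (algebraMap k F).toMonoidHom c)}

/-- `K₂(F)/Const`. -/
noncomputable abbrev K2ModConst (k F : Type) [Field k] [Field F] [Algebra k F] : Type :=
  MilnorK2 F ⧸ constSymbols k F

/-- The class of the symbol `{f, g}` in `K₂(F)/Const`, as a total function on `F`
(junk value `0` if `f` or `g` vanishes). -/
noncomputable def K2ModConst.symb (k : Type) {F : Type} [Field k] [Field F] [Algebra k F]
    (f g : F) : K2ModConst k F :=
  letI := Classical.propDecidable (f ≠ 0 ∧ g ≠ 0)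
  if h : f ≠ 0 ∧ g ≠ 0 then
    QuotientAddGroup.mk (MilnorK2.symbol (Units.mk0 f h.1) (Units.mk0 g h.2))
  else 0

/-- `dlog f = f⁻¹ · d f ∈ Ω_{F/k}`. -/
noncomputable def dlog (k : Type) {F : Type} [Field k] [Field F] [Algebra k F] (f : F) :
    Ω[F⁄k] :=
  f⁻¹ • (KaehlerDifferential.D k F) f

/-- The wedge `dlog f ∧ dlog g ∈ Ω²_{F/k}`, realized as a degree-two element of the
exterior algebra `Λ_F Ω_{F/k}` (in which `Ω²_{F/k} = Λ²_F Ω_{F/k}` embeds). -/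
noncomputable def dlogWedge (k : Type) {F : Type} [Field k] [Field F] [Algebra k F] (f g : F) :
    ExteriorAlgebra F (Ω[F⁄k]) :=
  ExteriorAlgebra.ι F (dlog k f) * ExteriorAlgebra.ι F (dlog k g)

namespace K2ModConst

section Symbols

variable {k F : Type} [Field k] [Field F] [Algebra k F]

theorem symb_eq_mk (f g : Fˣ) :
    symb k (f : F) (g : F) = QuotientAddGroup.mk (MilnorK2.symbol f g) := by
  simp only [symb]
  rw [dif_pos ⟨f.ne_zero, g.ne_zero⟩]
  simp

theorem symb_zero_left (g : F) : symb k 0 g = 0 := by simp [symb]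

theorem symb_zero_right (f : F) : symb k f 0 = 0 := by simp [symb]

theorem symb_mul_left {f f' : F} (hf : f ≠ 0) (hf' : f' ≠ 0) (g : F) :
    symb k (f * f') g = symb k f g + symb k f' g := by
  rcases eq_or_ne g 0 with rfl | hg
  · simp [symb_zero_right]
  lift f to Fˣ using hf.isUnit
  lift f' to Fˣ using hf'.isUnit
  lift g to Fˣ using hg.isUnit
  rw [← Units.val_mul, symb_eq_mk, symb_eq_mk, symb_eq_mk, ← QuotientAddGroup.mk_add]
  simp only [MilnorK2.symbol]
  rw [← Submodule.Quotient.mk_add, ← TensorProduct.add_tmul, ofMul_mul]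

theorem symb_mul_right (f : F) {g g' : F} (hg : g ≠ 0) (hg' : g' ≠ 0) :
    symb k f (g * g') = symb k f g + symb k f g' := by
  rcases eq_or_ne f 0 with rfl | hf
  · simp [symb_zero_left]
  lift f to Fˣ using hf.isUnit
  lift g to Fˣ using hg.isUnit
  lift g' to Fˣ using hg'.isUnit
  rw [← Units.val_mul, symb_eq_mk, symb_eq_mk, symb_eq_mk, ← QuotientAddGroup.mk_add]
  simp only [MilnorK2.symbol]
  rw [← Submodule.Quotient.mk_add, ← TensorProduct.tmul_add, ofMul_mul]

theorem symb_one_sub (f : F) : symb k f (1 - f) = 0 := by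
  rcases eq_or_ne f 0 with rfl | hf
  · exact symb_zero_left _
  rcases eq_or_ne (1 - f) 0 with h | h
  · rw [h, symb_zero_right]
  lift f to Fˣ using hf.isUnit
  have key : (1 - (f : F)) = (Units.mk0 _ h : Fˣ) := rfl
  rw [key, symb_eq_mk, MilnorK2.symbol, (Submodule.Quotient.mk_eq_zero _).mpr,
    QuotientAddGroup.mk_zero]
  exact Submodule.subset_span ⟨f, h, rfl⟩

theorem symb_const_right (f : F) (c : k) : symb k f (algebraMap k F c) = 0 := by
  rcases eq_or_ne f 0 with rfl | hf
  · exact symb_zero_left _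
  rcases eq_or_ne c 0 with rfl | hc
  · rw [map_zero, symb_zero_right]
  lift f to Fˣ using hf.isUnit
  lift c to kˣ using hc.isUnit
  have key : algebraMap k F c = (Units.map (algebraMap k F).toMonoidHom c : Fˣ) := rfl
  rw [key, symb_eq_mk, QuotientAddGroup.eq_zero_iff]
  exact AddSubgroup.subset_closure ⟨f, c, rfl⟩

theorem symb_one_right (f : F) : symb k f 1 = 0 := by
  simpa using symb_const_right (k := k) f 1

theorem symb_one_left (g : F) : symb k 1 g = 0 := by
  simpa using symb_mul_left (k := k) (one_ne_zero (α := F)) one_ne_zero g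

theorem symb_inv_left (f g : F) : symb k f⁻¹ g = -symb k f g := by
  rcases eq_or_ne f 0 with rfl | hf
  · simp [symb_zero_left]
  rw [← add_eq_zero_iff_eq_neg, ← symb_mul_left (inv_ne_zero hf) hf, inv_mul_cancel₀ hf,
    symb_one_left]

theorem symb_inv_right (f g : F) : symb k f g⁻¹ = -symb k f g := by
  rcases eq_or_ne g 0 with rfl | hg
  · simp [symb_zero_right]
  rw [← add_eq_zero_iff_eq_neg, ← symb_mul_right _ (inv_ne_zero hg) hg, inv_mul_cancel₀ hg,
    symb_one_right]

theorem symb_div_left {f f' : F} (hf : f ≠ 0) (hf' : f' ≠ 0) (g : F) :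
    symb k (f / f') g = symb k f g - symb k f' g := by
  rw [div_eq_mul_inv, symb_mul_left hf (inv_ne_zero hf'), symb_inv_left, sub_eq_add_neg]

theorem symb_div_right (f : F) {g g' : F} (hg : g ≠ 0) (hg' : g' ≠ 0) :
    symb k f (g / g') = symb k f g - symb k f g' := by
  rw [div_eq_mul_inv, symb_mul_right _ hg (inv_ne_zero hg'), symb_inv_right, sub_eq_add_neg]

theorem symb_neg_right (f g : F) : symb k f (-g) = symb k f g := by
  rcases eq_or_ne g 0 with rfl | hg
  · simp
  have := symb_const_right (k := k) f (-1)
  rw [map_neg, map_one] at this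
  rw [← neg_one_mul, symb_mul_right _ (by simp) hg, this, zero_add]

theorem symb_self (f : F) : symb k f f = 0 := by
  rcases eq_or_ne f 0 with rfl | hf
  · exact symb_zero_left _
  rcases eq_or_ne f 1 with rfl | h1
  · exact symb_one_left _
  have h2 : 1 - f ≠ 0 := sub_ne_zero.mpr h1.symm
  have h3 : 1 - f⁻¹ ≠ 0 := sub_ne_zero.mpr (by simpa [eq_comm] using h1)
  have key : -f = (1 - f) / (1 - f⁻¹) := by
    rw [eq_div_iff h3]
    field_simp
    ring
  have h4 := symb_one_sub (k := k) f⁻¹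
  rw [symb_inv_left, neg_eq_zero] at h4
  rw [← symb_neg_right, key, symb_div_right _ h2 h3, symb_one_sub, h4, sub_zero]

theorem symb_swap (f g : F) : symb k g f = -symb k f g := by
  rcases eq_or_ne f 0 with rfl | hf
  · simp [symb_zero_left, symb_zero_right]
  rcases eq_or_ne g 0 with rfl | hg
  · simp [symb_zero_left, symb_zero_right]
  have := symb_self (k := k) (f * g)
  rw [symb_mul_left hf hg, symb_mul_right _ hf hg, symb_mul_right _ hf hg, symb_self, symb_self,
    zero_add, add_zero] at this
  exact (neg_eq_of_add_eq_zero_right this).symm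

theorem symb_const_left (c : k) (g : F) : symb k (algebraMap k F c) g = 0 := by
  rw [symb_swap, symb_const_right, neg_zero]

theorem symb_eq_zero_of_add_eq_one {f g : F} (h : f + g = 1) : symb k f g = 0 := by
  rw [← symb_one_sub (k := k) f, ← h, add_sub_cancel_left]

theorem induction_on {P : K2ModConst k F → Prop} (ξ : K2ModConst k F)
    (zero : P 0) (symb : ∀ f g : F, f ≠ 0 → g ≠ 0 → P (symb k f g))
    (add : ∀ ξ η, P ξ → P η → P (ξ + η)) : P ξ := by
  obtain ⟨ξ, rfl⟩ := QuotientAddGroup.mk_surjective ξ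
  obtain ⟨t, rfl⟩ := Submodule.Quotient.mk_surjective _ ξ
  induction t using TensorProduct.induction_on with
  | zero => exact zero
  | tmul f g =>
    have := symb f.toMul g.toMul (Units.ne_zero _) (Units.ne_zero _)
    rwa [symb_eq_mk] at this
  | add s t hs ht =>
    rw [Submodule.Quotient.mk_add, QuotientAddGroup.mk_add]
    exact add _ _ hs ht

end Symbols

section Dlog

variable {k F : Type} [Field k] [Field F] [Algebra k F]

theorem dlog_mul {f g : F} (hf : f ≠ 0) (hg : g ≠ 0) :
    dlog k (f * g) = dlog k f + dlog k g := by
  simp only [dlog, Derivation.leibniz, smul_add, smul_smul]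
  rw [add_comm]
  congr 2 <;> field_simp

theorem dlogWedge_mul_left {f f' : F} (hf : f ≠ 0) (hf' : f' ≠ 0) (g : F) :
    dlogWedge k (f * f') g = dlogWedge k f g + dlogWedge k f' g := by
  simp only [dlogWedge, dlog_mul hf hf', map_add, add_mul]

theorem dlogWedge_mul_right (f : F) {g g' : F} (hg : g ≠ 0) (hg' : g' ≠ 0) :
    dlogWedge k f (g * g') = dlogWedge k f g + dlogWedge k f g' := by
  simp only [dlogWedge, dlog_mul hg hg', map_add, mul_add]

theorem dlogWedge_const_right (f : F) (c : k) : dlogWedge k f (algebraMap k F c) = 0 := by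
  simp [dlogWedge, dlog]

theorem dlogWedge_one_sub (f : F) : dlogWedge k f (1 - f) = 0 := by
  simp [dlogWedge, dlog]

/-- The homomorphism `{f, g} ↦ dlog f ∧ dlog g` on `K₂(F)/Const`. -/
noncomputable def dlogHom (k F : Type) [Field k] [Field F] [Algebra k F] :
    K2ModConst k F →+ ExteriorAlgebra F (Ω[F⁄k]) := by
  refine QuotientAddGroup.lift _ ((steinberg F).liftQ (TensorProduct.lift
    (AddMonoidHom.toIntLinearMap (AddMonoidHom.mk' (fun f ↦ AddMonoidHom.toIntLinearMap
      (AddMonoidHom.mk' (fun g ↦ dlogWedge k (f.toMul : F) (g.toMul : F)) ?_)) ?_)))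
    ?_).toAddMonoidHom ?_
  · intro g g'
    exact dlogWedge_mul_right _ (Units.ne_zero _) (Units.ne_zero _)
  · intro f f'
    ext g
    exact dlogWedge_mul_left (Units.ne_zero _) (Units.ne_zero _) _
  · rw [steinberg, Submodule.span_le]
    rintro _ ⟨f, h, rfl⟩
    exact dlogWedge_one_sub _
  · rw [constSymbols, AddSubgroup.closure_le]
    rintro _ ⟨f, c, rfl⟩
    exact dlogWedge_const_right _ _

theorem dlogHom_symb (f g : F) : dlogHom k F (symb k f g) = dlogWedge k f g := by
  rcases eq_or_ne f 0 with rfl | hf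
  · simp [symb_zero_left, dlogWedge, dlog]
  rcases eq_or_ne g 0 with rfl | hg
  · simp [symb_zero_right, dlogWedge, dlog]
  lift f to Fˣ using hf.isUnit
  lift g to Fˣ using hg.isUnit
  rw [symb_eq_mk]
  rfl

/-- Evaluation of `ω ∧ η` at the pair of derivations `(D₁, D₂)`. -/
noncomputable def evalWedge (D₁ D₂ : Derivation k F F) : ExteriorAlgebra F (Ω[F⁄k]) →ₗ[F] F :=
  ExteriorAlgebra.liftAlternating (R := F) (Function.update 0 2
    (Matrix.detRowAlternating.compLinearMap
      (LinearMap.pi ![D₁.liftKaehlerDifferential, D₂.liftKaehlerDifferential])))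

theorem evalWedge_dlogWedge (D₁ D₂ : Derivation k F F) (f g : F) :
    evalWedge D₁ D₂ (dlogWedge k f g) = (D₁ f * D₂ g - D₂ f * D₁ g) / (f * g) := by
  have h : dlogWedge k f g = ExteriorAlgebra.ιMulti F 2 ![dlog k f, dlog k g] := by
    simp [dlogWedge, ExteriorAlgebra.ιMulti_apply]
  rw [h, evalWedge, ExteriorAlgebra.liftAlternating_apply_ιMulti]
  simp only [Function.update_self, AlternatingMap.compLinearMap_apply]
  refine (Matrix.det_fin_two (Matrix.of fun i ↦ LinearMap.pi
    ![D₁.liftKaehlerDifferential, D₂.liftKaehlerDifferential] (![dlog k f, dlog k g] i))).trans ?_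
  simp [dlog]
  ring

end Dlog

end K2ModConst

section Derivations

open Polynomial

theorem Derivation.exists_extension_fractionRing {k R K : Type*} [CommRing k] [CommRing R]
    [Field K] [Algebra k R] [Algebra k K] [Algebra R K] [IsScalarTower k R K]
    [IsFractionRing R K] (d : Derivation k R R) :
    ∃ D : Derivation k K K, ∀ a, D (algebraMap R K a) = algebraMap R K (d a) := by
  have := Algebra.FormallyEtale.of_isLocalization (Rₘ := K) (nonZeroDivisors R)
  let e := KaehlerDifferential.isBaseChange_of_formallyEtale k R K
  let f : Ω[R⁄k] →ₗ[R] K := (Algebra.linearMap R K).comp d.liftKaehlerDifferential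
  refine ⟨(e.lift f).compDer (KaehlerDifferential.D k K), fun a ↦ ?_⟩
  have h := e.lift_eq f (KaehlerDifferential.D k R a)
  rw [KaehlerDifferential.map_D] at h
  simpa [f] using h

theorem Derivation.exists_polynomial_coeff {k E : Type*} [CommRing k] [CommRing E]
    [Algebra k E] (d : Derivation k E E) :
    ∃ δ : Derivation k E[X] E[X], ∀ p i, (δ p).coeff i = d (p.coeff i) :=
  ⟨PolynomialModule.equivPolynomialSelf.toLinearMap.compDer d.mapCoeffs, fun _ _ ↦ rfl⟩

theorem Derivation.exists_algebraMap_eq_of_fractionRing {k E : Type*} [Field k] [CharZero k]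
    [Field E] [Algebra k[X] E] [Algebra k E] [IsScalarTower k k[X] E] [IsFractionRing k[X] E]
    (d : Derivation k E E)
    (hd : ∀ p : k[X], d (algebraMap k[X] E p) = algebraMap k[X] E (derivative p))
    (a : E) (ha : d a = 0) : ∃ c : k, algebraMap k E c = a := by
  obtain ⟨u, ⟨v, hv⟩, huv, rfl⟩ := IsFractionRing.exists_reduced_fraction k[X] a
  rw [IsFractionRing.mk'_eq_div] at ha ⊢
  set a := algebraMap k[X] E u / algebraMap k[X] E v with ha_def
  have hv0 : v ≠ 0 := nonZeroDivisors.ne_zero hv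
  have hinj := IsFractionRing.injective k[X] E
  have hv1 : algebraMap k[X] E v ≠ 0 := by rwa [Ne, FaithfulSMul.algebraMap_eq_zero_iff]
  have hav : algebraMap k[X] E u = a * algebraMap k[X] E v := by
    rw [← div_eq_iff hv1]
  have h1 : algebraMap k[X] E (derivative u) = a * algebraMap k[X] E (derivative v) := by
    rw [← hd, ← hd, hav, Derivation.leibniz, ha]
    simp
  have h2 : derivative u * v = u * derivative v := by
    apply hinj
    rw [map_mul, map_mul, h1, hav]
    ring
  have h3 : derivative v = 0 := by
    have : v ∣ derivative v := huv.symm.dvd_of_dvd_mul_left (h2 ▸ dvd_mul_left _ _)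
    by_contra h
    exact absurd (degree_le_of_dvd this h) (not_le.mpr (degree_derivative_lt hv0))
  have h4 : derivative u = 0 := by
    rw [h3, mul_zero] at h2
    exact (mul_eq_zero.mp h2).resolve_right hv0
  rw [derivative_eq_zero] at h3 h4
  rw [eq_C_of_natDegree_eq_zero h3, eq_C_of_natDegree_eq_zero h4] at hav
  refine ⟨u.coeff 0 / v.coeff 0, ?_⟩
  have hC : ∀ c : k, algebraMap k[X] E (C c) = algebraMap k E c := fun c ↦
    (IsScalarTower.algebraMap_apply k k[X] E c).symm
  rw [hC, hC] at hav
  rw [map_div₀, hav, mul_div_cancel_right₀]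
  rw [← hC, ← eq_C_of_natDegree_eq_zero h3]
  exact hv1

theorem Derivation.apply_comp_of_coeff {k E : Type*} [CommRing k] [CommRing E] [Algebra k E]
    (d : Derivation k E E) (δ : Derivation k E[X] E[X])
    (hδ : ∀ p i, (δ p).coeff i = d (p.coeff i)) (m g : E[X]) :
    δ (m.comp g) = (δ m).comp g + (derivative m).comp g * δ g := by
  have hC : ∀ a, δ (C a) = C (d a) := by
    intro a
    ext i
    rw [hδ, coeff_C, coeff_C]
    split_ifs <;> simp
  have hX : δ X = 0 := by
    ext i
    rw [hδ, coeff_X]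
    split_ifs <;> simp
  induction m using Polynomial.induction_on' with
  | add p q hp hq => simp only [add_comp, map_add, hp, hq]; ring
  | monomial n a =>
    rw [← C_mul_X_pow_eq_monomial]
    simp [hC, hX, Derivation.leibniz, Derivation.leibniz_pow, derivative_X_pow]
    ring

theorem Polynomial.eq_C_algebraMap_of_dvd_jacobian {k E : Type*} [Field k] [IsAlgClosed k]
    [CharZero k] [Field E] [Algebra k E] (d : Derivation k E E)
    (hd : ∀ a, d a = 0 → ∃ c : k, algebraMap k E c = a)
    (δ : Derivation k E[X] E[X]) (hδ : ∀ p i, (δ p).coeff i = d (p.coeff i))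
    {p g : E[X]} (hp : Irreducible p) (hg : g.natDegree < p.natDegree)
    (h : p ∣ δ p * derivative g - derivative p * δ g) : ∃ c : k, g = C (algebraMap k E c) := by
  have : CharZero E := charZero_of_injective_algebraMap (algebraMap k E).injective
  have : Fact (Irreducible p) := ⟨hp⟩
  let π := AdjoinRoot.mk p
  have hcomp : ∀ q : E[X], π (q.comp g) = aeval (π g) q := by
    intro q
    rw [comp, eval₂_eq_sum, aeval_def, eval₂_eq_sum, Polynomial.sum, Polynomial.sum, map_sum]
    simp only [map_mul, map_pow]
    rfl
  have hint : IsIntegral E (π g) := by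
    have := (AdjoinRoot.powerBasis hp.ne_zero).finite
    exact IsIntegral.of_finite E _
  set m := minpoly E (π g) with hm
  obtain ⟨q, hq⟩ : p ∣ m.comp g := by
    rw [← AdjoinRoot.mk_eq_zero]
    exact (hcomp m).trans (minpoly.aeval E _)
  have h0 : π p = 0 := AdjoinRoot.mk_self
  have h1 := congrArg π (congrArg δ hq)
  rw [Derivation.apply_comp_of_coeff d δ hδ, Derivation.leibniz, map_add, map_add, map_mul,
    hcomp, smul_eq_mul, smul_eq_mul, map_mul, map_mul, h0] at h1
  have h2 := congrArg π (congrArg derivative hq)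
  rw [derivative_comp, derivative_mul, map_add, map_mul, map_mul, map_mul, h0] at h2
  have h3 : π (δ p * derivative g - derivative p * δ g) = 0 := AdjoinRoot.mk_eq_zero.mpr h
  rw [map_sub, map_mul, map_mul] at h3
  have h4 : π (derivative p) ≠ 0 := by
    rw [Ne, AdjoinRoot.mk_eq_zero]
    intro hdvd
    have h5 : derivative p ≠ 0 := by
      rw [Ne, derivative_eq_zero]
      omega
    exact absurd (degree_le_of_dvd hdvd h5) (not_le.mpr (degree_derivative_lt hp.ne_zero))
  have h5 : aeval (π g) (δ m) = 0 := by
    apply (mul_eq_zero.mp (?_ : aeval (π g) (δ m) * π (derivative p) = 0)).resolve_right h4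
    linear_combination π (derivative p) * h1 - π (δ p) * h2 + π ((derivative m).comp g) * h3
  have h6 : δ m = 0 := by
    by_contra hne
    have hdeg := minpoly.degree_le_of_ne_zero E _ hne h5
    refine absurd hdeg (not_le.mpr ?_)
    rw [degree_eq_natDegree (minpoly.ne_zero hint), degree_lt_iff_coeff_zero]
    intro i hi
    rw [hδ]
    rcases hi.eq_or_lt with rfl | hi
    · rw [(minpoly.monic hint).coeff_natDegree, Derivation.map_one_eq_zero]
    · rw [coeff_eq_zero_of_natDegree_lt hi, map_zero]
  have h7 : m ∈ lifts (algebraMap k E) := by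
    rw [lifts_iff_coeff_lifts]
    intro n
    obtain ⟨c, hc⟩ := hd (m.coeff n) (by rw [← hδ, h6, coeff_zero])
    exact ⟨c, hc⟩
  obtain ⟨m₀, hm₀, -, hmonic⟩ := lifts_and_degree_eq_and_monic h7 (minpoly.monic hint)
  have hk : IsIntegral k (π g) := by
    refine ⟨m₀, hmonic, ?_⟩
    rw [IsScalarTower.algebraMap_eq k E (AdjoinRoot p), ← eval₂_map, hm₀]
    exact minpoly.aeval E _
  obtain ⟨c, hc⟩ := hk.mem_range_algebraMap_of_minpoly_splits (K := k) (IsAlgClosed.splits _)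
  refine ⟨c, ?_⟩
  have h8 : p ∣ g - C (algebraMap k E c) := by
    rw [← AdjoinRoot.mk_eq_zero, map_sub, sub_eq_zero]
    exact hc.symm
  rw [← sub_eq_zero]
  refine eq_zero_of_dvd_of_natDegree_lt h8 ?_
  rwa [natDegree_sub_C]

end Derivations

namespace K2ModConst

section DegreeFiltration

open Polynomial

variable {k E F : Type} [Field k] [Field E] [Field F] [Algebra k F] [Algebra E[X] F]

variable (k F) in
/-- The symbol `{p, q}` of two polynomials, in `K₂/Const` of a field containing `E[X]`. -/
noncomputable def polySymb (p q : E[X]) : K2ModConst k F :=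
  symb k (algebraMap E[X] F p) (algebraMap E[X] F q)

variable (k E F) in
/-- The subgroup generated by the symbols of polynomials of degree at most `d`. -/
noncomputable def degreeLE (d : ℕ) : AddSubgroup (K2ModConst k F) :=
  AddSubgroup.closure {ξ | ∃ p q : E[X], p ≠ 0 ∧ q ≠ 0 ∧ p.natDegree ≤ d ∧ q.natDegree ≤ d ∧
    ξ = polySymb k F p q}

theorem polySymb_mem_degreeLE {d : ℕ} {p q : E[X]} (hp0 : p ≠ 0) (hq0 : q ≠ 0)
    (hp : p.natDegree ≤ d) (hq : q.natDegree ≤ d) : polySymb k F p q ∈ degreeLE k E F d :=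
  AddSubgroup.subset_closure ⟨p, q, hp0, hq0, hp, hq, rfl⟩

theorem degreeLE_mono : Monotone (degreeLE k E F) := fun _ _ h ↦
  AddSubgroup.closure_mono fun _ ⟨p, q, hp0, hq0, hp, hq, hξ⟩ ↦
    ⟨p, q, hp0, hq0, hp.trans h, hq.trans h, hξ⟩

theorem polySymb_swap (p q : E[X]) : polySymb k F q p = -polySymb k F p q := symb_swap _ _

theorem polySymb_self (p : E[X]) : polySymb k F p p = 0 := symb_self _

theorem polySymb_one_right (p : E[X]) : polySymb k F p 1 = 0 := by
  rw [polySymb, map_one, symb_one_right]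

variable [IsFractionRing E[X] F]

theorem algebraMap_ne_zero_of_ne_zero {p : E[X]} (hp : p ≠ 0) : algebraMap E[X] F p ≠ 0 := by
  rwa [Ne, FaithfulSMul.algebraMap_eq_zero_iff]

theorem polySymb_mul_left {p p' : E[X]} (hp : p ≠ 0) (hp' : p' ≠ 0) (q : E[X]) :
    polySymb k F (p * p') q = polySymb k F p q + polySymb k F p' q := by
  rw [polySymb, map_mul, symb_mul_left (algebraMap_ne_zero_of_ne_zero hp)
    (algebraMap_ne_zero_of_ne_zero hp')]
  rfl

theorem polySymb_mul_right (p : E[X]) {q q' : E[X]} (hq : q ≠ 0) (hq' : q' ≠ 0) :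
    polySymb k F p (q * q') = polySymb k F p q + polySymb k F p q' := by
  rw [polySymb, map_mul, symb_mul_right _ (algebraMap_ne_zero_of_ne_zero hq)
    (algebraMap_ne_zero_of_ne_zero hq')]
  rfl

/-- The Steinberg relation for `a / c + b / c = 1`. -/
theorem polySymb_of_add_eq {a b c : E[X]} (ha : a ≠ 0) (hb : b ≠ 0) (hc : c ≠ 0)
    (h : a + b = c) :
    polySymb k F a b = polySymb k F a c + polySymb k F c b := by
  have ha' := algebraMap_ne_zero_of_ne_zero (F := F) ha
  have hb' := algebraMap_ne_zero_of_ne_zero (F := F) hb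
  have hc' := algebraMap_ne_zero_of_ne_zero (F := F) hc
  have key := symb_eq_zero_of_add_eq_one (k := k)
    (f := algebraMap E[X] F a / algebraMap E[X] F c)
    (g := algebraMap E[X] F b / algebraMap E[X] F c)
    (by rw [← add_div, ← map_add, h, div_self hc'])
  rw [symb_div_left ha' hc', symb_div_right _ hb' hc', symb_div_right _ hb' hc', symb_self] at key
  simp only [polySymb]
  rw [← sub_eq_zero, ← key]
  abel

theorem exists_mem_degreeLE (ξ : K2ModConst k F) : ∃ d, ξ ∈ degreeLE k E F d := by
  induction ξ using induction_on with
  | zero => exact ⟨0, zero_mem _⟩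
  | add ξ η hξ hη =>
    obtain ⟨d, hd⟩ := hξ
    obtain ⟨e, he⟩ := hη
    exact ⟨max d e, add_mem (degreeLE_mono (le_max_left _ _) hd)
      (degreeLE_mono (le_max_right _ _) he)⟩
  | symb f g hf hg =>
    obtain ⟨a, b, hb, rfl⟩ := IsFractionRing.div_surjective E[X] f
    obtain ⟨u, v, hv, rfl⟩ := IsFractionRing.div_surjective E[X] g
    have hb := nonZeroDivisors.ne_zero hb
    have hv := nonZeroDivisors.ne_zero hv
    have ha : a ≠ 0 := by rintro rfl; simp at hf
    have hu : u ≠ 0 := by rintro rfl; simp at hg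
    have ha' := algebraMap_ne_zero_of_ne_zero (F := F) ha
    have hb' := algebraMap_ne_zero_of_ne_zero (F := F) hb
    have hu' := algebraMap_ne_zero_of_ne_zero (F := F) hu
    have hv' := algebraMap_ne_zero_of_ne_zero (F := F) hv
    refine ⟨a.natDegree + b.natDegree + u.natDegree + v.natDegree, ?_⟩
    rw [symb_div_left ha' hb', symb_div_right _ hu' hv', symb_div_right _ hu' hv']
    refine sub_mem (sub_mem ?_ ?_) (sub_mem ?_ ?_) <;>
      exact polySymb_mem_degreeLE ‹_› ‹_› (by omega) (by omega)

theorem polySymb_add_sub_mod_mem_degreeLE {d : ℕ} {p g g' : E[X]} (hp : Irreducible p)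
    (hd : p.natDegree = d + 1) (hg0 : g ≠ 0) (hg : g.natDegree ≤ d) (hg0' : g' ≠ 0)
    (hg' : g'.natDegree ≤ d) :
    g * g' % p ≠ 0 ∧ (g * g' % p).natDegree ≤ d ∧
      polySymb k F p g + polySymb k F p g' - polySymb k F p (g * g' % p) ∈ degreeLE k E F d := by
  have hp0 := hp.ne_zero
  have hgg : g * g' ≠ 0 := mul_ne_zero hg0 hg0'
  have hr0 : g * g' % p ≠ 0 := by
    intro h
    rw [EuclideanDomain.mod_eq_zero] at h
    rcases hp.prime.dvd_or_dvd h with h | h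
    · have := natDegree_le_of_dvd h hg0
      omega
    · have := natDegree_le_of_dvd h hg0'
      omega
  have hr : (g * g' % p).natDegree ≤ d := by
    have := natDegree_mod_lt (g * g') (q := p) (by omega)
    omega
  refine ⟨hr0, hr, ?_⟩
  rw [← polySymb_mul_right _ hg0 hg0']
  have hdiv := EuclideanDomain.div_add_mod (g * g') p
  rcases eq_or_ne (g * g' / p) 0 with hq | hq
  · rw [hq, mul_zero, zero_add] at hdiv
    rw [hdiv, sub_self]
    exact zero_mem _
  have hqd : (g * g' / p).natDegree ≤ d := by
    have h1 : (p * (g * g' / p)).natDegree ≤ max (g * g').natDegree (g * g' % p).natDegree := by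
      rw [eq_sub_of_add_eq hdiv]
      exact natDegree_sub_le _ _
    rw [natDegree_mul hp0 hq, natDegree_mul hg0 hg0'] at h1
    omega
  have key := polySymb_of_add_eq (k := k) (F := F) (mul_ne_zero hp0 hq) hr0 hgg hdiv
  rw [polySymb_mul_left hp0 hq, polySymb_mul_left hp0 hq, polySymb_mul_left hg0 hg0',
    polySymb_mul_right (g * g' / p) hg0 hg0'] at key
  have key' : polySymb k F p (g * g') - polySymb k F p (g * g' % p) =
      polySymb k F (g * g' / p) (g * g' % p) - (polySymb k F (g * g' / p) g
        + polySymb k F (g * g' / p) g') - polySymb k F g (g * g' % p)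
        - polySymb k F g' (g * g' % p) := by
    rw [← sub_eq_zero] at key ⊢
    rw [← neg_eq_zero, ← key]
    abel
  rw [key']
  refine sub_mem (sub_mem (sub_mem ?_ (add_mem ?_ ?_)) ?_) ?_ <;>
    exact polySymb_mem_degreeLE ‹_› ‹_› ‹_› ‹_›

variable (k E F) in
/-- The subgroup generated by the symbols `{p, g}` with `p` monic irreducible of degree `d + 1`
and `g` of degree at most `d`. -/
noncomputable def primeSymbols (d : ℕ) : AddSubgroup (K2ModConst k F) :=
  AddSubgroup.closure {ξ | ∃ p g : E[X], p.Monic ∧ Irreducible p ∧ p.natDegree = d + 1 ∧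
    g ≠ 0 ∧ g.natDegree ≤ d ∧ ξ = polySymb k F p g}

theorem _root_.Polynomial.exists_eq_mul_lower_or_prime {d : ℕ} {p : E[X]} (hp0 : p ≠ 0)
    (hp : p.natDegree ≤ d + 1) :
    ∃ a b : E[X], (a ≠ 0 ∧ a.natDegree ≤ d) ∧ ((b ≠ 0 ∧ b.natDegree ≤ d) ∨
      (b.Monic ∧ Irreducible b ∧ b.natDegree = d + 1)) ∧ p = a * b := by
  rcases hp.lt_or_eq with hlt | heq
  · exact ⟨p, 1, ⟨hp0, by omega⟩, Or.inl ⟨one_ne_zero, by simp⟩, by simp⟩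
  by_cases hirr : Irreducible p
  · have hl : p.leadingCoeff ≠ 0 := leadingCoeff_ne_zero.mpr hp0
    refine ⟨C p.leadingCoeff, p * C p.leadingCoeff⁻¹, ⟨C_ne_zero.mpr hl, by simp⟩, Or.inr
      ⟨monic_mul_leadingCoeff_inv hp0, irreducible_mul_leadingCoeff_inv.mpr hirr, ?_⟩, ?_⟩
    · rw [natDegree_mul_leadingCoeff_inv _ hp0, heq]
    · rw [mul_left_comm, ← C_mul, mul_inv_cancel₀ hl, C_1, mul_one]
  · have hu : ¬ IsUnit p := fun h ↦ by
      have := natDegree_eq_zero_of_isUnit h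
      omega
    rw [irreducible_iff] at hirr
    push Not at hirr
    obtain ⟨a, b, rfl, ha, hb⟩ := hirr hu
    have ha0 : a ≠ 0 := left_ne_zero_of_mul hp0
    have hb0 : b ≠ 0 := right_ne_zero_of_mul hp0
    have ha1 : a.natDegree ≠ 0 := fun h ↦ ha (by
      rw [isUnit_iff_degree_eq_zero, degree_eq_natDegree ha0, h]; rfl)
    have hb1 : b.natDegree ≠ 0 := fun h ↦ hb (by
      rw [isUnit_iff_degree_eq_zero, degree_eq_natDegree hb0, h]; rfl)
    rw [natDegree_mul ha0 hb0] at heq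
    exact ⟨a, b, ⟨ha0, by omega⟩, Or.inl ⟨hb0, by omega⟩, rfl⟩

theorem polySymb_mem_of_lower_or_prime {d : ℕ} {a b : E[X]}
    (ha : (a ≠ 0 ∧ a.natDegree ≤ d) ∨ (a.Monic ∧ Irreducible a ∧ a.natDegree = d + 1))
    (hb : (b ≠ 0 ∧ b.natDegree ≤ d) ∨ (b.Monic ∧ Irreducible b ∧ b.natDegree = d + 1)) :
    polySymb k F a b ∈ primeSymbols k E F d ⊔ degreeLE k E F d := by
  have hprime : ∀ {p g : E[X]}, p.Monic → Irreducible p → p.natDegree = d + 1 → g ≠ 0 →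
      g.natDegree ≤ d → polySymb k F p g ∈ primeSymbols k E F d ⊔ degreeLE k E F d :=
    fun h1 h2 h3 h4 h5 ↦ AddSubgroup.mem_sup_left
      (AddSubgroup.subset_closure ⟨_, _, h1, h2, h3, h4, h5, rfl⟩)
  rcases ha with ⟨ha0, ha⟩ | ⟨ham, hai, had⟩ <;> rcases hb with ⟨hb0, hb⟩ | ⟨hbm, hbi, hbd⟩
  · exact AddSubgroup.mem_sup_right (polySymb_mem_degreeLE ha0 hb0 ha hb)
  · rw [polySymb_swap]
    exact neg_mem (hprime hbm hbi hbd ha0 ha)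
  · exact hprime ham hai had hb0 hb
  · rcases eq_or_ne b a with rfl | hne
    · rw [polySymb_self]
      exact zero_mem _
    have hr0 : b - a ≠ 0 := sub_ne_zero.mpr hne
    have hr : (b - a).natDegree ≤ d := by
      have hdeg : b.degree = a.degree := by
        rw [degree_eq_natDegree hbm.ne_zero, degree_eq_natDegree ham.ne_zero, hbd, had]
      have := natDegree_lt_natDegree hr0 (degree_sub_lt_left hdeg hbm.ne_zero
        (by rw [hbm.leadingCoeff, ham.leadingCoeff]))
      omega
    have key := polySymb_of_add_eq (k := k) (F := F) ham.ne_zero hr0 hbm.ne_zero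
      (add_sub_cancel a b)
    rw [eq_sub_of_add_eq key.symm]
    exact sub_mem (hprime ham hai had hr0 hr) (hprime hbm hbi hbd hr0 hr)

theorem degreeLE_succ_le (d : ℕ) :
    degreeLE k E F (d + 1) ≤ primeSymbols k E F d ⊔ degreeLE k E F d := by
  rw [degreeLE, AddSubgroup.closure_le]
  rintro _ ⟨p, q, hp0, hq0, hp, hq, rfl⟩
  obtain ⟨a, b, ha, hb, rfl⟩ := exists_eq_mul_lower_or_prime hp0 hp
  obtain ⟨a', b', ha', hb', rfl⟩ := exists_eq_mul_lower_or_prime hq0 hq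
  have hb'0 := right_ne_zero_of_mul hq0
  rw [polySymb_mul_left ha.1 (right_ne_zero_of_mul hp0), polySymb_mul_right _ ha'.1 hb'0,
    polySymb_mul_right _ ha'.1 hb'0]
  refine add_mem (add_mem ?_ ?_) (add_mem ?_ ?_) <;> apply polySymb_mem_of_lower_or_prime <;> tauto

theorem exists_sum_polySymb_of_mem_primeSymbols {d : ℕ} {ξ : K2ModConst k F}
    (hξ : ξ ∈ primeSymbols k E F d) :
    ∃ (T : Finset E[X]) (g : E[X] → E[X]),
      (∀ p ∈ T, p.Monic ∧ Irreducible p ∧ p.natDegree = d + 1) ∧ (∀ p ∉ T, g p = 1) ∧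
      (∀ p, g p ≠ 0 ∧ (g p).natDegree ≤ d) ∧
      ξ - ∑ p ∈ T, polySymb k F p (g p) ∈ degreeLE k E F d := by
  classical
  have hsub : ∀ {T T' : Finset E[X]} {g : E[X] → E[X]}, (∀ p ∉ T, g p = 1) → T ⊆ T' →
      ∑ p ∈ T, polySymb k F p (g p) = ∑ p ∈ T', polySymb k F p (g p) := fun hg hT ↦
    Finset.sum_subset hT fun p _ hp ↦ by rw [hg p hp, polySymb_one_right]
  induction hξ using AddSubgroup.closure_induction with
  | mem ξ hξ =>
    obtain ⟨p, g, hpm, hpi, hpd, hg0, hg, rfl⟩ := hξ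
    refine ⟨{p}, Function.update (fun _ ↦ 1) p g, by simp [hpm, hpi, hpd], ?_, fun q ↦ ?_, ?_⟩
    · intro q hq
      rw [Function.update_of_ne (by simpa using hq)]
    · rcases eq_or_ne q p with rfl | hq
      · simpa using ⟨hg0, hg⟩
      · simp [Function.update_of_ne hq]
    · simp [zero_mem]
  | zero => exact ⟨∅, fun _ ↦ 1, by simp, by simp, by simp, by simp [zero_mem]⟩
  | add ξ η _ _ hξ hη =>
    obtain ⟨T, g, hT, hg1, hg, hgξ⟩ := hξ
    obtain ⟨T', g', hT', hg1', hg', hgη⟩ := hη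
    have hU : ∀ p ∈ T ∪ T', p.Monic ∧ Irreducible p ∧ p.natDegree = d + 1 := fun p hp ↦
      (Finset.mem_union.mp hp).elim (hT p) (hT' p)
    have key : ∀ p ∈ T ∪ T', _ := fun p hp ↦ polySymb_add_sub_mod_mem_degreeLE (k := k) (F := F)
      (hU p hp).2.1 (hU p hp).2.2 (hg p).1 (hg p).2 (hg' p).1 (hg' p).2
    refine ⟨T ∪ T', fun p ↦ if p ∈ T ∪ T' then g p * g' p % p else 1, hU,
      fun p hp ↦ if_neg hp, fun p ↦ ?_, ?_⟩
    · dsimp only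
      split_ifs with hp
      · exact ⟨(key p hp).1, (key p hp).2.1⟩
      · simp
    · rw [hsub hg1 Finset.subset_union_left] at hgξ
      rw [hsub hg1' Finset.subset_union_right] at hgη
      have h := add_mem (add_mem hgξ hgη) (sum_mem fun p hp ↦ (key p hp).2.2)
      rw [Finset.sum_sub_distrib, Finset.sum_add_distrib] at h
      have hsum : ∑ p ∈ T ∪ T', polySymb k F p (if p ∈ T ∪ T' then g p * g' p % p else 1) =
          ∑ p ∈ T ∪ T', polySymb k F p (g p * g' p % p) :=
        Finset.sum_congr rfl fun p hp ↦ by rw [if_pos hp]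
      rw [hsum]
      convert h using 1
      abel
  | neg ξ _ hξ =>
    obtain ⟨T, g, hT, hg1, hg, hgξ⟩ := hξ
    have key : ∀ p, ∃ h : E[X], (p ∉ T → h = 1) ∧ (h ≠ 0 ∧ h.natDegree ≤ d) ∧
        (p ∈ T → polySymb k F p (g p) + polySymb k F p h ∈ degreeLE k E F d) := by
      intro p
      by_cases hp : p ∈ T
      swap
      · exact ⟨1, fun _ ↦ rfl, by simp, fun h ↦ absurd h hp⟩
      obtain ⟨hpm, hpi, hpd⟩ := hT p hp
      have hcop : IsCoprime p (g p) := hpi.coprime_iff_not_dvd.mpr fun hdvd ↦ by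
        have := natDegree_le_of_dvd hdvd (hg p).1
        have := (hg p).2
        omega
      obtain ⟨v, u, huv⟩ := hcop
      have hmod : g p * (u % p) % p = 1 := by
        have h1 : (1 : E[X]) % p = 1 := by
          rw [mod_eq_self_iff hpi.ne_zero, degree_one, degree_eq_natDegree hpi.ne_zero, hpd]
          exact_mod_cast d.succ_pos
        rw [← h1]
        refine mod_eq_of_dvd_sub ⟨-(g p * (u / p) + v), ?_⟩
        linear_combination g p * EuclideanDomain.div_add_mod u p + huv
      have hu : (u % p).natDegree ≤ d := by
        have := natDegree_mod_lt u (q := p) (by omega)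
        omega
      have hu0 : u % p ≠ 0 := by
        intro h
        rw [h, mul_zero, EuclideanDomain.zero_mod] at hmod
        exact zero_ne_one hmod
      have h := (polySymb_add_sub_mod_mem_degreeLE (k := k) (F := F) hpi hpd
        (hg p).1 (hg p).2 hu0 hu).2.2
      rw [hmod, polySymb_one_right, sub_zero] at h
      exact ⟨u % p, fun h ↦ absurd hp h, ⟨hu0, hu⟩, fun _ ↦ h⟩
    choose h h1 h2 h3 using key
    refine ⟨T, h, hT, h1, h2, ?_⟩
    have h4 := add_mem hgξ (sum_mem h3)
    rw [Finset.sum_add_distrib] at h4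
    rw [← neg_add', neg_mem_iff]
    convert h4 using 1
    abel

end DegreeFiltration

end K2ModConst

namespace K2ModConst

section Residue

open Polynomial

variable {k E F : Type} [Field k] [Field E] [Field F] [Algebra k F] [Algebra E[X] F]

variable (F) in
/-- The elements of the fraction field of `E[X]` that are integral at the prime `p`. -/
def integralAt {p : E[X]} (hp : Irreducible p) : AddSubgroup F where
  carrier := {f | ∃ a b : E[X], ¬ p ∣ b ∧ f * algebraMap E[X] F b = algebraMap E[X] F a}
  zero_mem' := ⟨0, 1, fun h ↦ hp.not_isUnit (isUnit_of_dvd_one h), by simp⟩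
  add_mem' := by
    rintro f g ⟨a, b, hb, hf⟩ ⟨a', b', hb', hg⟩
    refine ⟨a * b' + a' * b, b * b', hp.prime.not_dvd_mul hb hb', ?_⟩
    simp only [map_add, map_mul]
    linear_combination algebraMap E[X] F b' * hf + algebraMap E[X] F b * hg
  neg_mem' := by
    rintro f ⟨a, b, hb, hf⟩
    exact ⟨-a, b, hb, by rw [map_neg, ← hf, neg_mul]⟩

theorem degreeLE_zero_eq_bot
    (hE : ∀ a b : E, polySymb k F (C a) (C b) = 0) : degreeLE k E F 0 = ⊥ := by
  rw [degreeLE, AddSubgroup.closure_eq_bot_iff]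
  rintro _ ⟨p, q, -, -, hp, hq, rfl⟩
  rw [eq_C_of_natDegree_le_zero hp, eq_C_of_natDegree_le_zero hq, hE]
  rfl

theorem polySymb_algebraMap_right [Algebra k E] [IsScalarTower k E[X] F] (p : E[X]) (c : k) :
    polySymb k F p (C (algebraMap k E c)) = 0 := by
  have h : algebraMap E[X] F (C (algebraMap k E c)) = algebraMap k F c :=
    (IsScalarTower.algebraMap_apply k E[X] F c).symm
  rw [polySymb, h, symb_const_right]

variable (D₁ D₂ : Derivation k F F)

theorem evalWedge_dlogHom_polySymb (a b : E[X]) :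
    evalWedge D₁ D₂ (dlogHom k F (polySymb k F a b)) =
      (D₁ (algebraMap E[X] F a) * D₂ (algebraMap E[X] F b) -
        D₂ (algebraMap E[X] F a) * D₁ (algebraMap E[X] F b)) /
        (algebraMap E[X] F a * algebraMap E[X] F b) := by
  rw [polySymb, dlogHom_symb, evalWedge_dlogWedge]

variable [IsFractionRing E[X] F] {D₁ D₂} {δ₁ δ₂ : E[X] → E[X]}

theorem evalWedge_dlogHom_polySymb_mem_integralAt
    (h₁ : ∀ p, D₁ (algebraMap E[X] F p) = algebraMap E[X] F (δ₁ p))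
    (h₂ : ∀ p, D₂ (algebraMap E[X] F p) = algebraMap E[X] F (δ₂ p))
    {p : E[X]} (hp : Irreducible p) {a b : E[X]}
    (ha : ¬ p ∣ a) (hb : ¬ p ∣ b) :
    evalWedge D₁ D₂ (dlogHom k F (polySymb k F a b)) ∈ integralAt F hp := by
  have ha0 : a ≠ 0 := fun h ↦ ha (h ▸ dvd_zero p)
  have hb0 : b ≠ 0 := fun h ↦ hb (h ▸ dvd_zero p)
  refine ⟨δ₁ a * δ₂ b - δ₂ a * δ₁ b, a * b, hp.prime.not_dvd_mul ha hb, ?_⟩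
  rw [evalWedge_dlogHom_polySymb, h₁, h₁, h₂, h₂, map_mul, div_mul_cancel₀]
  · simp only [map_sub, map_mul]
  · exact mul_ne_zero (algebraMap_ne_zero_of_ne_zero ha0) (algebraMap_ne_zero_of_ne_zero hb0)

theorem evalWedge_dlogHom_mem_integralAt
    (h₁ : ∀ p, D₁ (algebraMap E[X] F p) = algebraMap E[X] F (δ₁ p))
    (h₂ : ∀ p, D₂ (algebraMap E[X] F p) = algebraMap E[X] F (δ₂ p))
    {d : ℕ} {p : E[X]} (hp : Irreducible p)
    (hd : p.natDegree = d + 1) {ξ : K2ModConst k F} (hξ : ξ ∈ degreeLE k E F d) :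
    evalWedge D₁ D₂ (dlogHom k F ξ) ∈ integralAt F hp := by
  have hdvd : ∀ {a : E[X]}, a ≠ 0 → a.natDegree ≤ d → ¬ p ∣ a := fun ha0 ha h ↦ by
    have := natDegree_le_of_dvd h ha0
    omega
  induction hξ using AddSubgroup.closure_induction with
  | mem ξ hξ =>
    obtain ⟨a, b, ha0, hb0, ha, hb, rfl⟩ := hξ
    exact evalWedge_dlogHom_polySymb_mem_integralAt h₁ h₂ hp (hdvd ha0 ha) (hdvd hb0 hb)
  | zero => simp [zero_mem]
  | add ξ η _ _ hξ hη =>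
    rw [map_add, map_add]
    exact add_mem hξ hη
  | neg ξ _ hξ =>
    rw [map_neg, map_neg]
    exact neg_mem hξ

theorem dvd_jacobian_of_mem_integralAt
    (h₁ : ∀ p, D₁ (algebraMap E[X] F p) = algebraMap E[X] F (δ₁ p))
    (h₂ : ∀ p, D₂ (algebraMap E[X] F p) = algebraMap E[X] F (δ₂ p))
    {p g : E[X]} (hp : Irreducible p) (hg : g ≠ 0)
    (h : evalWedge D₁ D₂ (dlogHom k F (polySymb k F p g)) ∈ integralAt F hp) :
    p ∣ δ₁ p * δ₂ g - δ₂ p * δ₁ g := by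
  obtain ⟨a, b, hb, hab⟩ := h
  refine (hp.prime.dvd_or_dvd (?_ : p ∣ (δ₁ p * δ₂ g - δ₂ p * δ₁ g) * b)).resolve_right hb
  refine ⟨g * a, FaithfulSMul.algebraMap_injective E[X] F ?_⟩
  have hp' := algebraMap_ne_zero_of_ne_zero (F := F) hp.ne_zero
  have hg' := algebraMap_ne_zero_of_ne_zero (F := F) hg
  rw [evalWedge_dlogHom_polySymb, h₁, h₁, h₂, h₂, div_mul_eq_mul_div,
    div_eq_iff (mul_ne_zero hp' hg')] at hab
  simp only [map_mul, map_sub]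
  linear_combination hab

variable [IsAlgClosed k] [CharZero k] [Algebra k E] [IsScalarTower k E[X] F]

theorem mem_degreeLE_of_evalWedge_dlogHom_eq_zero (d : Derivation k E E)
    (hd : ∀ a, d a = 0 → ∃ c : k, algebraMap k E c = a)
    (δ : Derivation k E[X] E[X]) (hδ : ∀ p i, (δ p).coeff i = d (p.coeff i))
    (h₁ : ∀ p, D₁ (algebraMap E[X] F p) = algebraMap E[X] F (δ p))
    (h₂ : ∀ p, D₂ (algebraMap E[X] F p) = algebraMap E[X] F (derivative p))
    {n : ℕ} {ξ : K2ModConst k F} (hξ : ξ ∈ degreeLE k E F (n + 1))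
    (h0 : evalWedge D₁ D₂ (dlogHom k F ξ) = 0) : ξ ∈ degreeLE k E F n := by
  classical
  obtain ⟨σ, hσ, τ, hτ, rfl⟩ := AddSubgroup.mem_sup.mp (degreeLE_succ_le n hξ)
  obtain ⟨T, g, hT, -, hg, hgσ⟩ := exists_sum_polySymb_of_mem_primeSymbols hσ
  suffices hsum : ∑ p ∈ T, polySymb k F p (g p) = 0 by
    rw [hsum, sub_zero] at hgσ
    exact add_mem hgσ hτ
  refine Finset.sum_eq_zero fun p hp ↦ ?_
  obtain ⟨hpm, hpi, hpd⟩ := hT p hp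
  have hmem : evalWedge D₁ D₂ (dlogHom k F (polySymb k F p (g p))) ∈ integralAt F hpi := by
    have hrest : ∑ q ∈ T.erase p, evalWedge D₁ D₂ (dlogHom k F (polySymb k F q (g q))) ∈
        integralAt F hpi := by
      refine sum_mem fun q hq ↦ evalWedge_dlogHom_polySymb_mem_integralAt h₁ h₂ hpi ?_ ?_
      · obtain ⟨hqp, hqT⟩ := Finset.mem_erase.mp hq
        obtain ⟨hqm, hqi, hqd⟩ := hT q hqT
        intro hdvd
        exact hqp (eq_of_monic_of_associated hqm hpm (hpi.associated_of_dvd hqi hdvd).symm)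
      · intro hdvd
        have := natDegree_le_of_dvd hdvd (hg q).1
        have := (hg q).2
        omega
    have h3 := evalWedge_dlogHom_mem_integralAt h₁ h₂ hpi hpd (add_mem hgσ hτ)
    have h4 : σ + τ = polySymb k F p (g p) + ∑ q ∈ T.erase p, polySymb k F q (g q) +
        (σ - ∑ q ∈ T, polySymb k F q (g q) + τ) := by
      rw [Finset.add_sum_erase T (fun q ↦ polySymb k F q (g q)) hp]
      abel
    rw [h4, map_add, map_add, map_add, map_add, map_sum, map_sum] at h0
    rw [eq_neg_of_add_eq_zero_left ((add_assoc _ _ _).symm.trans h0)]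
    exact neg_mem (add_mem hrest h3)
  obtain ⟨c, hc⟩ := eq_C_algebraMap_of_dvd_jacobian d hd δ hδ hpi
    (by have := (hg p).2; omega) (dvd_jacobian_of_mem_integralAt h₁ h₂ hpi (hg p).1 hmem)
  rw [hc, polySymb_algebraMap_right]

variable (F) in
theorem dlogHom_injective_of_derivation (d : Derivation k E E)
    (hd : ∀ a, d a = 0 → ∃ c : k, algebraMap k E c = a)
    (hE : ∀ a b : E, polySymb k F (C a) (C b) = 0) :
    Function.Injective (dlogHom k F) := by
  obtain ⟨δ, hδ⟩ := d.exists_polynomial_coeff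
  obtain ⟨D₁, h₁⟩ := δ.exists_extension_fractionRing (K := F)
  obtain ⟨D₂, h₂⟩ := Derivation.exists_extension_fractionRing (K := F)
    (derivative' (R := E) |>.restrictScalars k)
  rw [injective_iff_map_eq_zero]
  intro ξ hξ
  obtain ⟨n, hn⟩ := exists_mem_degreeLE (E := E) ξ
  induction n with
  | zero => rwa [degreeLE_zero_eq_bot hE, AddSubgroup.mem_bot] at hn
  | succ n ih =>
    exact ih (mem_degreeLE_of_evalWedge_dlogHom_eq_zero d hd δ hδ h₁ h₂ hn (by rw [hξ, map_zero]))

end Residue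

section RationalFunctions

open Polynomial

variable {k E F : Type} [Field k] [Field E] [Field F] [Algebra k F] [IsAlgClosed k]

/-- Symbols of rational functions in one variable over an algebraically closed field are
constant. -/
theorem symb_algebraMap_eq_zero [Algebra k E] [Algebra k[X] E] [IsScalarTower k k[X] E]
    [IsFractionRing k[X] E] (f : E →ₐ[k] F) (a b : E) : symb k (f a) (f b) = 0 := by
  let ι : k[X] →ₐ[k] F := f.comp (IsScalarTower.toAlgHom k k[X] E)
  have hι : Function.Injective ι := f.injective.comp (IsFractionRing.injective k[X] E)
  have hι0 : ∀ {p : k[X]}, p ≠ 0 → ι p ≠ 0 := fun hp ↦ (map_ne_zero_iff ι hι).mpr hp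
  have hιC : ∀ c : k, ι (C c) = algebraMap k F c := fun c ↦ ι.commutes c
  have ind : ∀ (P : k[X] → Prop), (∀ c, P (C c)) → (∀ c, P (X - C c)) →
      (∀ p q, p ≠ 0 → q ≠ 0 → P p → P q → P (p * q)) → ∀ p, P p := by
    intro P hC hX hmul p
    induction p using UniqueFactorizationMonoid.induction_on_prime with
    | h₁ => simpa using hC 0
    | h₂ u hu =>
      obtain ⟨c, -, rfl⟩ := isUnit_iff.mp hu
      exact hC c
    | h₃ a p ha hp ih =>
      refine hmul p a hp.ne_zero ha ?_ ih
      obtain ⟨r, hr⟩ := exists_root_of_degree_eq_one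
        (IsAlgClosed.degree_eq_one_of_irreducible k hp.irreducible)
      obtain ⟨u, rfl⟩ := ((irreducible_X_sub_C r).associated_of_dvd hp.irreducible
        (dvd_iff_isRoot.mpr hr))
      obtain ⟨c, -, hc⟩ := isUnit_iff.mp u.isUnit
      exact hmul _ _ (X_sub_C_ne_zero r) u.ne_zero (hX r) (hc ▸ hC c)
  have hlin : ∀ r s : k, symb k (ι (X - C r)) (ι (X - C s)) = 0 := by
    intro r s
    rcases eq_or_ne r s with rfl | hrs
    · exact symb_self _
    have hc : algebraMap k F (s - r) ≠ 0 := by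
      rw [Ne, FaithfulSMul.algebraMap_eq_zero_iff]
      exact sub_ne_zero.mpr hrs.symm
    have key := symb_eq_zero_of_add_eq_one (k := k)
      (f := ι (X - C r) / algebraMap k F (s - r)) (g := -ι (X - C s) / algebraMap k F (s - r)) (by
        rw [← add_div, div_eq_one_iff_eq hc, map_sub, map_sub, hιC, hιC, map_sub]
        ring)
    rwa [symb_div_left (hι0 (X_sub_C_ne_zero r)) hc, symb_const_left, sub_zero,
      symb_div_right _ (neg_ne_zero.mpr (hι0 (X_sub_C_ne_zero s))) hc, symb_const_right, sub_zero,
      symb_neg_right] at key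
  have hpoly : ∀ p q : k[X], symb k (ι p) (ι q) = 0 := by
    refine ind _ (fun c q ↦ by rw [hιC, symb_const_left]) (fun r ↦ ?_)
      (fun p p' hp hp' h h' q ↦ by rw [map_mul, symb_mul_left (hι0 hp) (hι0 hp'), h, h', add_zero])
    exact ind _ (fun c ↦ by rw [hιC, symb_const_right]) (hlin r)
      (fun q q' hq hq' h h' ↦ by
        rw [map_mul, symb_mul_right _ (hι0 hq) (hι0 hq'), h, h', add_zero])
  obtain ⟨p, q, hq, rfl⟩ := IsFractionRing.div_surjective k[X] a
  obtain ⟨u, v, hv, rfl⟩ := IsFractionRing.div_surjective k[X] b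
  have hq' := hι0 (nonZeroDivisors.ne_zero hq)
  have hv' := hι0 (nonZeroDivisors.ne_zero hv)
  have hdiv : ∀ p q : k[X], f (algebraMap k[X] E p / algebraMap k[X] E q) = ι p / ι q :=
    fun p q ↦ map_div₀ f _ _
  rw [hdiv, hdiv]
  rcases eq_or_ne (ι p) 0 with hp | hp
  · rw [hp, zero_div, symb_zero_left]
  rcases eq_or_ne (ι u) 0 with hu | hu
  · rw [hu, zero_div, symb_zero_right]
  simp [symb_div_left hp hq', symb_div_right _ hu hv', hpoly]

end RationalFunctions

end K2ModConst

namespace K2ModConst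

section RationalFunctionField

open Polynomial

variable (k F : Type) [Field k] [IsAlgClosed k] [CharZero k] [Field F] [Algebra k F]

theorem dlogHom_injective_of_isFractionRing [Algebra k[X][X] F] [IsScalarTower k k[X][X] F]
    [IsFractionRing k[X][X] F] : Function.Injective (dlogHom k F) := by
  let E := FractionRing k[X]
  let : Algebra k[X][X] E[X] := Polynomial.algebra k[X] E
  let M : Submonoid k[X][X] := (nonZeroDivisors k[X]).map (C : k[X] →+* k[X][X])
  have hloc : IsLocalization M E[X] := Polynomial.isLocalization _ _
  have hM : M ≤ nonZeroDivisors k[X][X] := by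
    rintro _ ⟨p, hp, rfl⟩
    exact mem_nonZeroDivisors_of_ne_zero (C_ne_zero.mpr (nonZeroDivisors.ne_zero hp))
  have hu : ∀ y : M, IsUnit (algebraMap k[X][X] F y) := fun y ↦
    IsLocalization.map_units F (⟨y, hM y.2⟩ : nonZeroDivisors k[X][X])
  let ψ : E[X] →+* F := IsLocalization.lift hu
  let : Algebra E[X] F := ψ.toAlgebra
  have hψ : ∀ p, ψ (algebraMap k[X][X] E[X] p) = algebraMap k[X][X] F p :=
    IsLocalization.lift_eq hu
  have : IsScalarTower k[X][X] E[X] F := .of_algebraMap_eq fun p ↦ (hψ p).symm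
  have : IsFractionRing E[X] F :=
    IsFractionRing.isFractionRing_of_isDomain_of_isLocalization M E[X] F
  have hk : ∀ c : k, ψ (C (algebraMap k E c)) = algebraMap k F c := fun c ↦ by
    rw [IsScalarTower.algebraMap_apply k k[X][X] F, ← hψ]
    congr 1
    exact (map_C (algebraMap k[X] E)).symm
  have : IsScalarTower k E[X] F := .of_algebraMap_eq fun c ↦ (hk c).symm
  obtain ⟨d, hd⟩ := Derivation.exists_extension_fractionRing (K := E) (derivative' (R := k))
  let f : E →ₐ[k] F := { ψ.comp C with commutes' := hk }
  exact dlogHom_injective_of_derivation F d (Derivation.exists_algebraMap_eq_of_fractionRing d hd)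
    (symb_algebraMap_eq_zero f)

theorem dlogHom_injective [Algebra (MvPolynomial (Fin 2) k) F]
    [IsScalarTower k (MvPolynomial (Fin 2) k) F] [IsFractionRing (MvPolynomial (Fin 2) k) F] :
    Function.Injective (dlogHom k F) := by
  let e : MvPolynomial (Fin 2) k ≃ₐ[k] k[X][X] := (MvPolynomial.finSuccEquiv k 1).trans
    (Polynomial.mapAlgEquiv (MvPolynomial.uniqueAlgEquiv k (Fin 1)))
  let : Algebra k[X][X] F :=
    ((algebraMap (MvPolynomial (Fin 2) k) F).comp e.symm.toRingEquiv.toRingHom).toAlgebra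
  have : IsScalarTower k k[X][X] F := .of_algebraMap_eq fun c ↦ by
    rw [IsScalarTower.algebraMap_apply k (MvPolynomial (Fin 2) k) F, ← e.symm.commutes c]
    rfl
  have : IsFractionRing k[X][X] F :=
    .of_ringEquiv_left e.symm.toRingEquiv fun _ ↦ rfl
  exact dlogHom_injective_of_isFractionRing k F

end RationalFunctionField

end K2ModConst

/-- Let `k` be an algebraically closed field of characteristic 0 and
`F = k(x,y)`. Let `φ* : F → F` be an injective `k`-algebra homomorphism (the pullback of a
dominant rational self-map of `𝔸²`). Then `φ*` fixes the symbol `{x,y}` in `K₂(F)/Const` if and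
only if it fixes the logarithmic volume form `dlog x ∧ dlog y` in `Ω²_{F/k}`. -/
theorem symb_fixed_iff_logVolumeForm_fixed
    (k : Type) [Field k] [IsAlgClosed k] [CharZero k]
    (φ : FractionRing (MvPolynomial (Fin 2) k) →ₐ[k] FractionRing (MvPolynomial (Fin 2) k))
    (hφ : Function.Injective φ)
    (x y : FractionRing (MvPolynomial (Fin 2) k))
    (hx : x = algebraMap (MvPolynomial (Fin 2) k) _ (MvPolynomial.X 0))
    (hy : y = algebraMap (MvPolynomial (Fin 2) k) _ (MvPolynomial.X 1)) :
    K2ModConst.symb k (φ x) (φ y) = K2ModConst.symb k x y ↔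
      dlogWedge k (φ x) (φ y) = dlogWedge k x y := by
  rw [← K2ModConst.dlogHom_symb, ← K2ModConst.dlogHom_symb]
  exact (K2ModConst.dlogHom_injective k _).eq_iff.symm
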